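/- arXiv:1304.5159 — 2 statements merged into one kernel-verified Lean document; each statement's English description precedes it below -/
import Mathlib

section
/- For every n ≥ 1 there exists a nonempty finite set Γ_n of functions α : S → ℝ (α vectors) such that V_n(b) = max_{α ∈ Γ_n} Σ_s α(s) b(s) for all beliefs b; i.e., the optimal value function V_n of I-POMDP Lite is piecewise linear and convex. -/
open Finset

noncomputable section

variable {S U V O : Type*}

/-- `b : S → ℝ` is a belief (probability distribution over states). -/
def IsBelief [Fintype S] (b : S → ℝ) : Prop :=
  (∀ s, 0 ≤ b s) ∧ ∑ s, b s = 1

/-- `P : S → V → ℝ` is a (mixed) strategy of the other agent. -/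
def IsStrategy [Fintype V] (P : S → V → ℝ) : Prop :=
  (∀ s v, 0 ≤ P s v) ∧ ∀ s, ∑ v, P s v = 1

/-- Expected immediate payoff `R_P(b,u) = Σ_{s,v} b(s) P(s,v) R(s,u,v)`. -/
def expR [Fintype S] [Fintype V] (R : S → U → V → ℝ) (P : S → V → ℝ)
    (b : S → ℝ) (u : U) : ℝ :=
  ∑ s, ∑ v, b s * P s v * R s u v

/-- Belief-state observation model
`Pr_P(v,o|b,u) = Σ_{s'} Z(s',u,o) Σ_s T(s,u,v,s') P(s,v) b(s)`. -/
def obsPr [Fintype S] (T : S → U → V → S → ℝ) (Z : S → U → O → ℝ)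
    (P : S → V → ℝ) (b : S → ℝ) (u : U) (v : V) (o : O) : ℝ :=
  ∑ s', Z s' u o * ∑ s, T s u v s' * P s v * b s

/-- Unnormalized belief update
`F_P(b,u,v,o)(s') = Z(s',u,o) Σ_s T(s,u,v,s') P(s,v) b(s)`. -/
def unnormUpd [Fintype S] (T : S → U → V → S → ℝ) (Z : S → U → O → ℝ)
    (P : S → V → ℝ) (b : S → ℝ) (u : U) (v : V) (o : O) (s' : S) : ℝ :=
  Z s' u o * ∑ s, T s u v s' * P s v * b s

/-- Normalized belief update `B_P(b,u,v,o)`. -/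
def beliefUpd [Fintype S] (T : S → U → V → S → ℝ) (Z : S → U → O → ℝ)
    (P : S → V → ℝ) (b : S → ℝ) (u : U) (v : V) (o : O) (s' : S) : ℝ :=
  unnormUpd T Z P b u v o s' / obsPr T Z P b u v o

/-- Value function of I-POMDP Lite: `V^P_0(b) = 0` and
`V^P_{n+1}(b) = max_u [ R_P(b,u) + φ Σ_{v,o} Pr_P(v,o|b,u) V^P_n(B_P(b,u,v,o)) ]`
(summands with `Pr_P(v,o|b,u) = 0` vanish since they are multiplied by `0`). -/
def valFun [Fintype S] [Fintype U] [Fintype V] [Fintype O] [Nonempty U]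
    (T : S → U → V → S → ℝ) (Z : S → U → O → ℝ) (R : S → U → V → ℝ)
    (P : S → V → ℝ) (φ : ℝ) : ℕ → (S → ℝ) → ℝ
  | 0, _ => 0
  | n + 1, b => ⨆ u : U, (expR R P b u +
      φ * ∑ v, ∑ o, obsPr T Z P b u v o * valFun T Z R P φ n (beliefUpd T Z P b u v o))

/-- Q-function of I-POMDP Lite: `qFun … n` is `Q^P_{n+1}`, i.e.
`Q^P_{n+1}(b,u) = R_P(b,u) + φ Σ_{v,o} Pr_P(v,o|b,u) V^P_n(B_P(b,u,v,o))`,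
so that `V^P_{n+1}(b) = max_u (qFun … n b u)`. -/
def qFun [Fintype S] [Fintype U] [Fintype V] [Fintype O] [Nonempty U]
    (T : S → U → V → S → ℝ) (Z : S → U → O → ℝ) (R : S → U → V → ℝ)
    (P : S → V → ℝ) (φ : ℝ) (n : ℕ) (b : S → ℝ) (u : U) : ℝ :=
  expR R P b u +
    φ * ∑ v, ∑ o, obsPr T Z P b u v o * valFun T Z R P φ n (beliefUpd T Z P b u v o)

/-- Prediction error `ε_p = max_{s,v} |Pr*(s,v) − Pr(s,v)|`. -/
def predErr [Fintype S] [Fintype V] [Nonempty S] [Nonempty V]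
    (Pstar Ppred : S → V → ℝ) : ℝ :=
  ⨆ s : S, ⨆ v : V, |Pstar s v - Ppred s v|

/-- Expected total reward of executing the (greedy) policy `π` under the true
strategy `Pstar`: `J_0(b) = 0` and
`J_{k+1}(b) = R_{P*}(b,π_{k+1}(b)) + φ Σ_{v,o} Pr_{P*}(v,o|b,π_{k+1}(b)) J_k(B_{P*}(b,π_{k+1}(b),v,o))`. -/
def execJ [Fintype S] [Fintype V] [Fintype O]
    (T : S → U → V → S → ℝ) (Z : S → U → O → ℝ) (R : S → U → V → ℝ)
    (Pstar : S → V → ℝ) (φ : ℝ) (π : ℕ → (S → ℝ) → U) : ℕ → (S → ℝ) → ℝ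
  | 0, _ => 0
  | k + 1, b =>
      expR R Pstar b (π (k + 1) b) +
        φ * ∑ v, ∑ o, obsPr T Z Pstar b (π (k + 1) b) v o *
          execJ T Z R Pstar φ π k (beliefUpd T Z Pstar b (π (k + 1) b) v o)

/-- `Γ` is a set of `α` vectors representing `f` on beliefs: `f` is the pointwise maximum
over `Γ` of the linear functions `b ↦ Σ_s α(s) b(s)`. -/
def IsAlphaRepr [Fintype S] (Γ : Finset (S → ℝ)) (f : (S → ℝ) → ℝ) : Prop :=
  ∀ b, IsBelief b →
    (∀ α ∈ Γ, ∑ s, α s * b s ≤ f b) ∧ ∃ α ∈ Γ, ∑ s, α s * b s = f b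

/-- The `α` vector obtained by playing `u` first and then collecting the value of the `α`
vector `g v o` after seeing the other agent's action `v` and the observation `o`. -/
def backup [Fintype S] [Fintype V] [Fintype O]
    (T : S → U → V → S → ℝ) (Z : S → U → O → ℝ) (R : S → U → V → ℝ)
    (P : S → V → ℝ) (φ : ℝ) (u : U) (g : V → O → S → ℝ) (s : S) : ℝ :=
  (∑ v, P s v * R s u v) +
    φ * ∑ v, ∑ o, ∑ s', g v o s' * (Z s' u o * (T s u v s' * P s v))

theorem sum_backup_mul [Fintype S] [Fintype V] [Fintype O]
    (T : S → U → V → S → ℝ) (Z : S → U → O → ℝ) (R : S → U → V → ℝ)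
    (P : S → V → ℝ) (φ : ℝ) (u : U) (g : V → O → S → ℝ) (b : S → ℝ) :
    ∑ s, backup T Z R P φ u g s * b s =
      expR R P b u + φ * ∑ v, ∑ o, ∑ s', g v o s' * unnormUpd T Z P b u v o s' := by
  simp only [backup, expR, unnormUpd, add_mul, sum_add_distrib, mul_assoc, ← mul_sum, sum_mul]
  congr 1
  · refine sum_congr rfl fun s _ => ?_
    rw [mul_sum]
    refine sum_congr rfl fun v _ => ?_
    ring
  · congr 1
    rw [sum_comm]
    refine sum_congr rfl fun v _ => ?_
    rw [sum_comm]
    refine sum_congr rfl fun o _ => ?_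
    rw [sum_comm]
    refine sum_congr rfl fun s' _ => ?_
    simp only [mul_sum]

theorem unnormUpd_nonneg [Fintype S] {T : S → U → V → S → ℝ} {Z : S → U → O → ℝ}
    {P : S → V → ℝ} {b : S → ℝ} (hT : ∀ s u v s', 0 ≤ T s u v s') (hZ : ∀ s' u o, 0 ≤ Z s' u o)
    (hP : ∀ s v, 0 ≤ P s v) (hb : ∀ s, 0 ≤ b s) (u : U) (v : V) (o : O) (s' : S) :
    0 ≤ unnormUpd T Z P b u v o s' :=
  mul_nonneg (hZ _ _ _) (sum_nonneg fun s _ =>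
    mul_nonneg (mul_nonneg (hT _ _ _ _) (hP _ _)) (hb s))

/-- An `α`-vector representation extends to unnormalized beliefs by homogeneity. -/
theorem IsAlphaRepr.homogeneous [Fintype S] {Γ : Finset (S → ℝ)} {f : (S → ℝ) → ℝ}
    (h : IsAlphaRepr Γ f) (hΓ : Γ.Nonempty) {w : S → ℝ} (hw : ∀ s, 0 ≤ w s) :
    (∀ α ∈ Γ, ∑ s, α s * w s ≤ (∑ s, w s) * f fun s => w s / ∑ t, w t) ∧
      ∃ α ∈ Γ, ∑ s, α s * w s = (∑ s, w s) * f fun s => w s / ∑ t, w t := by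
  rcases (sum_nonneg fun s _ => hw s : 0 ≤ ∑ s, w s).eq_or_lt with h0 | hpos
  · have hw0 : ∀ s, w s = 0 := fun s =>
      (sum_eq_zero_iff_of_nonneg fun s _ => hw s).1 h0.symm s (mem_univ s)
    obtain ⟨α, hα⟩ := hΓ
    exact ⟨fun β _ => by simp [hw0], α, hα, by simp [hw0]⟩
  · have hb : IsBelief fun s => w s / ∑ t, w t :=
      ⟨fun s => div_nonneg (hw s) hpos.le, by rw [← sum_div, div_self hpos.ne']⟩
    have key : ∀ α : S → ℝ,
        ∑ s, α s * w s = (∑ s, w s) * ∑ s, α s * (w s / ∑ t, w t) := fun α => by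
      rw [mul_sum]
      refine sum_congr rfl fun s _ => ?_
      field_simp
    obtain ⟨hle, α, hα, heq⟩ := h _ hb
    exact ⟨fun β hβ => by rw [key]; exact mul_le_mul_of_nonneg_left (hle β hβ) hpos.le,
      α, hα, by rw [key, heq]⟩

theorem exists_isAlphaRepr_valFun [Fintype S] [Fintype U] [Fintype V] [Fintype O] [Nonempty U]
    {T : S → U → V → S → ℝ} {Z : S → U → O → ℝ} {P : S → V → ℝ} {φ : ℝ} (R : S → U → V → ℝ)
    (hT : ∀ s u v s', 0 ≤ T s u v s') (hZ : ∀ s' u o, 0 ≤ Z s' u o)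
    (hP : ∀ s v, 0 ≤ P s v) (hφ : 0 ≤ φ) (n : ℕ) :
    ∃ Γ : Finset (S → ℝ), Γ.Nonempty ∧ IsAlphaRepr Γ (valFun T Z R P φ n) := by
  classical
  induction n with
  | zero => exact ⟨{0}, singleton_nonempty 0, fun b _ => by simp [valFun]⟩
  | succ n ih =>
    obtain ⟨Γ, hΓ, hrep⟩ := ih
    have : Nonempty Γ := hΓ.to_subtype
    refine ⟨univ.image fun p : U × (V → O → Γ) =>
      backup T Z R P φ p.1 fun v o => (p.2 v o : S → ℝ), univ_nonempty.image _, fun b hb => ?_⟩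
    have step := fun u v o =>
      hrep.homogeneous hΓ (unnormUpd_nonneg (b := b) hT hZ hP hb.1 u v o)
    have hval : valFun T Z R P φ (n + 1) b = ⨆ u, qFun T Z R P φ n b u := rfl
    rw [hval]
    constructor
    · intro α hα
      obtain ⟨⟨u, g⟩, -, rfl⟩ := mem_image.1 hα
      rw [sum_backup_mul]
      refine le_trans ?_ (le_ciSup (Set.finite_range (qFun T Z R P φ n b)).bddAbove u)
      exact add_le_add_right (mul_le_mul_of_nonneg_left
        (sum_le_sum fun v _ => sum_le_sum fun o _ => (step u v o).1 _ (g v o).2) hφ) _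
    · obtain ⟨u, hu⟩ := exists_eq_ciSup_of_finite (f := qFun T Z R P φ n b)
      choose g hg hgeq using fun v o => (step u v o).2
      refine ⟨_, mem_image_of_mem _ (mem_univ (u, fun v o => ⟨g v o, hg v o⟩)), ?_⟩
      rw [sum_backup_mul, ← hu]
      simp only [hgeq]
      rfl

/-- **Theorem 3 (Piecewise Linearity and Convexity):** for every `n ≥ 1` the optimal
value function `V_n` of I-POMDP Lite is representable by a nonempty finite set of
`α` vectors: `V_n(b) = max_{α ∈ Γ_n} Σ_s α(s) b(s)`. -/
theorem ipomdp_lite_pwlc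
    [Fintype S] [Fintype U] [Fintype V] [Fintype O]
    [Nonempty S] [Nonempty U] [Nonempty V] [Nonempty O]
    (T : S → U → V → S → ℝ) (Z : S → U → O → ℝ) (R : S → U → V → ℝ)
    (Pr : S → V → ℝ) (φ : ℝ)
    (hT0 : ∀ s u v s', 0 ≤ T s u v s') (hT1 : ∀ s u v, ∑ s', T s u v s' = 1)
    (hZ0 : ∀ s' u o, 0 ≤ Z s' u o) (hZ1 : ∀ s' u, ∑ o, Z s' u o = 1)
    (hφ0 : 0 < φ) (hφ1 : φ < 1)
    (hPr : IsStrategy Pr)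
    (n : ℕ) (hn : 1 ≤ n) :
    ∃ (Γ : Finset (S → ℝ)) (hΓ : Γ.Nonempty),
      ∀ b : S → ℝ, IsBelief b →
        valFun T Z R Pr φ n b = Γ.sup' hΓ (fun α => ∑ s, α s * b s) := by
  obtain ⟨Γ, hΓ, h⟩ := exists_isAlphaRepr_valFun R hT0 hZ0 hPr.1 hφ0.le n
  refine ⟨Γ, hΓ, fun b hb => ?_⟩
  obtain ⟨hle, α, hα, heq⟩ := h b hb
  exact le_antisymm (heq ▸ le_sup' (fun α => ∑ s, α s * b s) hα) (sup'_le hΓ _ hle)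
end
end

section
/- For every belief b, action u ∈ U, action v ∈ V and observation o ∈ O such that Pr_{Pr*}(v,o|b,u) > 0 and Pr_{Pr}(v,o|b,u) > 0: Pr_{Pr*}(v,o|b,u) · Σ_{s'} |B_{Pr*}(b,u,v,o)(s') − B_{Pr}(b,u,v,o)(s')| ≤ 2 ε_p. -/
open Finset

noncomputable section

variable {S U V O : Type*}

/-- Normalizing nonnegative vectors at most doubles their `ℓ¹` distance, after weighting by
the mass of the first one. -/
theorem sum_mul_sum_abs_div_sum_sub_le {ι : Type*} [Fintype ι] (f g : ι → ℝ)
    (hg : ∀ i, 0 ≤ g i) (hf' : 0 < ∑ i, f i) (hg' : 0 < ∑ i, g i) :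
    (∑ i, f i) * ∑ i, |f i / (∑ j, f j) - g i / (∑ j, g j)| ≤ 2 * ∑ i, |f i - g i| := by
  set p := ∑ i, f i with hp
  set q := ∑ i, g i with hq
  have hpq : |q - p| ≤ ∑ i, |f i - g i| := by
    rw [abs_sub_comm, hp, hq, ← Finset.sum_sub_distrib]
    exact Finset.abs_sum_le_sum_abs _ _
  have key : ∀ i, p * |f i / p - g i / q| ≤ |f i - g i| + g i * (|q - p| / q) := by
    intro i
    calc p * |f i / p - g i / q| = |p * (f i / p - g i / q)| := by
          rw [abs_mul, abs_of_pos hf']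
      _ = |(f i - g i) + g i * ((q - p) / q)| := by
          congr 1
          field_simp
          ring
      _ ≤ |f i - g i| + |g i * ((q - p) / q)| := abs_add_le _ _
      _ = |f i - g i| + g i * (|q - p| / q) := by
          rw [abs_mul, abs_div, abs_of_nonneg (hg i), abs_of_pos hg']
  calc p * ∑ i, |f i / p - g i / q| = ∑ i, p * |f i / p - g i / q| := Finset.mul_sum _ _ _
    _ ≤ ∑ i, (|f i - g i| + g i * (|q - p| / q)) := Finset.sum_le_sum fun i _ => key i
    _ = ∑ i, |f i - g i| + |q - p| := by
        rw [Finset.sum_add_distrib, ← Finset.sum_mul, ← hq, mul_div_cancel₀ _ hg'.ne']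
    _ ≤ 2 * ∑ i, |f i - g i| := by linarith

theorem abs_sub_le_predErr [Fintype S] [Fintype V] [Nonempty S] [Nonempty V]
    (P Q : S → V → ℝ) (s : S) (v : V) : |P s v - Q s v| ≤ predErr P Q :=
  (le_ciSup (f := fun v => |P s v - Q s v|) (Set.finite_range _).bddAbove v).trans
    (le_ciSup (f := fun s => ⨆ v, |P s v - Q s v|) (Set.finite_range _).bddAbove s)

theorem sum_abs_unnormUpd_sub_le_predErr [Fintype S] [Fintype V] [Fintype O]
    [Nonempty S] [Nonempty V] (T : S → U → V → S → ℝ) (Z : S → U → O → ℝ) (P Q : S → V → ℝ)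
    (hT0 : ∀ s u v s', 0 ≤ T s u v s') (hT1 : ∀ s u v, ∑ s', T s u v s' = 1)
    (hZ0 : ∀ s' u o, 0 ≤ Z s' u o) (hZ1 : ∀ s' u, ∑ o, Z s' u o = 1)
    {b : S → ℝ} (hb : IsBelief b) (u : U) (v : V) (o : O) :
    ∑ s', |unnormUpd T Z P b u v o s' - unnormUpd T Z Q b u v o s'| ≤ predErr P Q := by
  have hZ (s' : S) : Z s' u o ≤ 1 :=
    hZ1 s' u ▸ Finset.single_le_sum (fun o _ => hZ0 s' u o) (Finset.mem_univ o)
  calc ∑ s', |unnormUpd T Z P b u v o s' - unnormUpd T Z Q b u v o s'|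
      ≤ ∑ s', ∑ s, T s u v s' * (predErr P Q * b s) := by
        refine Finset.sum_le_sum fun s' _ => ?_
        rw [unnormUpd, unnormUpd, ← mul_sub, ← Finset.sum_sub_distrib, abs_mul,
          abs_of_nonneg (hZ0 s' u o)]
        refine (mul_le_of_le_one_left (abs_nonneg _) (hZ s')).trans
          ((Finset.abs_sum_le_sum_abs _ _).trans (Finset.sum_le_sum fun s _ => ?_))
        rw [← sub_mul, ← mul_sub, abs_mul, abs_mul, abs_of_nonneg (hT0 s u v s'),
          abs_of_nonneg (hb.1 s), mul_assoc]
        exact mul_le_mul_of_nonneg_left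
          (mul_le_mul_of_nonneg_right (abs_sub_le_predErr P Q s v) (hb.1 s)) (hT0 s u v s')
    _ = predErr P Q := by
        rw [Finset.sum_comm]
        simp_rw [← Finset.sum_mul, hT1, one_mul, ← Finset.mul_sum, hb.2, mul_one]

/-- **Proposition 1:** the (weighted) ℓ¹ distance between the normalized belief
updates under the true and predicted strategies satisfies
`Pr_{Pr*}(v,o|b,u) · Σ_{s'} |B_{Pr*}(b,u,v,o)(s') − B_{Pr}(b,u,v,o)(s')| ≤ 2 ε_p`. -/
theorem ipomdp_lite_belief_update_diff
    [Fintype S] [Fintype U] [Fintype V] [Fintype O]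
    [Nonempty S] [Nonempty U] [Nonempty V] [Nonempty O]
    (T : S → U → V → S → ℝ) (Z : S → U → O → ℝ)
    (Pstar Ppred : S → V → ℝ)
    (hT0 : ∀ s u v s', 0 ≤ T s u v s') (hT1 : ∀ s u v, ∑ s', T s u v s' = 1)
    (hZ0 : ∀ s' u o, 0 ≤ Z s' u o) (hZ1 : ∀ s' u, ∑ o, Z s' u o = 1)
    (hPstar : IsStrategy Pstar) (hPpred : IsStrategy Ppred) :
    ∀ b : S → ℝ, IsBelief b → ∀ (u : U) (v : V) (o : O),
      0 < obsPr T Z Pstar b u v o → 0 < obsPr T Z Ppred b u v o →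
      obsPr T Z Pstar b u v o *
        ∑ s', |beliefUpd T Z Pstar b u v o s' - beliefUpd T Z Ppred b u v o s'| ≤
          2 * predErr Pstar Ppred := by
  intro b hb u v o hp hq
  have hG (s' : S) : 0 ≤ unnormUpd T Z Ppred b u v o s' :=
    mul_nonneg (hZ0 _ _ _) (Finset.sum_nonneg fun s _ =>
      mul_nonneg (mul_nonneg (hT0 _ _ _ _) (hPpred.1 s v)) (hb.1 s))
  have h := sum_mul_sum_abs_div_sum_sub_le (unnormUpd T Z Pstar b u v o)
    (unnormUpd T Z Ppred b u v o) hG hp hq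
  exact h.trans (mul_le_mul_of_nonneg_left
    (sum_abs_unnormUpd_sub_le_predErr T Z Pstar Ppred hT0 hT1 hZ0 hZ1 hb u v o) zero_le_two)
end
end
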